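/- Suppose m_opt ∈ L²(Ω₀, μ) minimizes E_wc over L²(Ω₀, μ). Then there exists a Borel probability measure Π on S (S with its supremum-norm topology) such that for μ-almost every ξ ∈ Ω₀, m_opt(ξ) · ∫_S |v(ξ)|² dΠ(v) = ∫_S conj(v(ξ))·v(α·ξ) dΠ(v); in particular m_opt = (∫_S conj(v)·v(α·) dΠ(v)ysis) / (∫_S |v|² dΠ(v)) μ-almost everywhere on the set where the denominator is nonzero. -/

import Mathlib

open MeasureTheory Set Pointwise
open scoped Classical

noncomputable section

variable {d : ℕ} {α : ℝ} {Ω₀ : Set (EuclideanSpace ℝ (Fin d))}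

def vLow (v : C(↥(Ω₀ ∪ α • Ω₀), ℂ)) (ξ : EuclideanSpace ℝ (Fin d)) : ℂ :=
  if h : ξ ∈ Ω₀ then v ⟨ξ, Or.inl h⟩ else 0

def vHigh (v : C(↥(Ω₀ ∪ α • Ω₀), ℂ)) (ξ : EuclideanSpace ℝ (Fin d)) : ℂ :=
  if h : ξ ∈ Ω₀ then v ⟨α • ξ, Or.inr (smul_mem_smul_set h)⟩ else 0

def Eapp (μ : Measure (EuclideanSpace ℝ (Fin d)))
    (v : C(↥(Ω₀ ∪ α • Ω₀), ℂ)) (m : Lp ℂ 2 (μ.restrict Ω₀)) : ℝ :=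
  (1 / 2) * ∫ ξ in Ω₀, ‖vHigh v ξ - m ξ * vLow v ξ‖ ^ 2 ∂μ

def Ewc (μ : Measure (EuclideanSpace ℝ (Fin d))) (S : Set C(↥(Ω₀ ∪ α • Ω₀), ℂ))
    (m : Lp ℂ 2 (μ.restrict Ω₀)) : ℝ :=
  sSup ((fun v => Eapp μ v m) '' S)

theorem exists_isProbabilityMeasure_integral_eq_zero {X : Type*} [TopologicalSpace X]
    [CompactSpace X] [T2Space X] [MeasurableSpace X] [BorelSpace X] (V : Submodule ℝ C(X, ℝ))
    (hV : ∀ φ ∈ V, ∃ x, φ x ≤ 0) :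
    ∃ P : Measure X, IsProbabilityMeasure P ∧ ∀ φ ∈ V, ∫ x, φ x ∂P = 0 := by
  let s : Set C(X, ℝ) := {φ | ∀ x, 0 < φ x}
  have hs_open : IsOpen s := by
    have := ContinuousMap.isOpen_setOfPred_mapsTo (X := X) (Y := ℝ) isCompact_univ
      (isOpen_Ioi (a := (0 : ℝ)))
    convert this using 1
    ext φ
    simp [s, MapsTo]
  have hs_conv : Convex ℝ s := by
    intro φ hφ ψ hψ a b ha hb hab x
    have h1 := hφ x
    have h2 := hψ x
    simp only [ContinuousMap.add_apply, ContinuousMap.smul_apply, smul_eq_mul]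
    rcases ha.eq_or_lt with rfl | ha
    · have : b = 1 := by linarith
      subst this
      linarith
    · have := mul_pos ha h1
      have := mul_nonneg hb h2.le
      linarith
  have hdisj : Disjoint s (V : Set C(X, ℝ)) := by
    rw [Set.disjoint_left]
    intro φ hφ hφV
    obtain ⟨x, hx⟩ := hV φ hφV
    exact absurd (hφ x) (not_lt.2 hx)
  obtain ⟨F, u, hF, hFV⟩ := geometric_hahn_banach_open hs_conv hs_open V.convex hdisj
  have hu : u ≤ 0 := by simpa using hFV 0 V.zero_mem
  have hFV0 : ∀ φ ∈ V, F φ = 0 := by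
    intro φ hφ
    by_contra hne
    have := hFV _ (V.smul_mem ((u - 1) / F φ) hφ)
    rw [map_smul, smul_eq_mul, div_mul_cancel₀ _ hne] at this
    linarith
  have hF1 : F 1 < 0 := (hF 1 fun x => by simp).trans_le hu
  have hFnonneg : ∀ φ : C(X, ℝ), (∀ x, 0 ≤ φ x) → F φ ≤ 0 := by
    intro φ hφ
    by_contra! hpos
    have hε : 0 < F φ / (-F 1) := div_pos hpos (by linarith)
    have := hF (φ + (F φ / (-F 1)) • (1 : C(X, ℝ))) fun x => by
      have := hφ x
      simp only [ContinuousMap.add_apply, ContinuousMap.smul_apply, smul_eq_mul,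
        ContinuousMap.one_apply, mul_one]
      linarith
    rw [map_add, map_smul, smul_eq_mul] at this
    have h3 : F φ / (-F 1) * F 1 = - F φ := by
      rw [div_neg, neg_mul, div_mul_cancel₀ _ hF1.ne]
    linarith
  let Λ : CompactlySupportedContinuousMap X ℝ →ₚ[ℝ] ℝ := PositiveLinearMap.mk₀
    { toFun := fun φ => - F φ.toContinuousMap
      map_add' := fun φ ψ => by
        have : (φ + ψ).toContinuousMap = φ.toContinuousMap + ψ.toContinuousMap := rfl
        rw [this, map_add]
        ring
      map_smul' := fun c φ => by
        have : (c • φ).toContinuousMap = c • φ.toContinuousMap := rfl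
        rw [this, map_smul]
        simp }
    (fun φ hφ => by
      have := hFnonneg φ.toContinuousMap hφ
      simpa using this)
  let ν : Measure X := RealRMK.rieszMeasure Λ
  have hν : ∀ φ : C(X, ℝ), ∫ x, φ x ∂ν = - F φ := fun φ =>
    RealRMK.integral_rieszMeasure Λ (CompactlySupportedContinuousMap.continuousMapEquiv φ)
  have hν0 : ν ≠ 0 := by
    intro h0
    have := hν 1
    rw [h0, integral_zero_measure] at this
    linarith
  have : NeZero ν := ⟨hν0⟩
  refine ⟨(ν univ)⁻¹ • ν, isProbabilityMeasureSMul, fun φ hφ => ?_⟩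
  rw [integral_smul_measure, hν, hFV0 φ hφ]
  simp

theorem continuous_integral_re_mul_conj {X Ω : Type*} [TopologicalSpace X]
    [FirstCountableTopology X] [MeasurableSpace X] [MeasurableSpace Ω] (ν : Measure Ω)
    (k : X → Ω → ℂ) (B : Ω → ℝ)
    (hk : Measurable (Function.uncurry k)) (hkc : ∀ ω, Continuous fun x => k x ω)
    (hB : MemLp B 2 ν) (hkB : ∀ x ω, ‖k x ω‖ ≤ B ω) (h : Ω → ℂ) (hh : MemLp h 2 ν) :
    Continuous fun x => ∫ ω, (k x ω * (starRingEnd ℂ) (h ω)).re ∂ν := by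
  refine continuous_of_dominated (fun x => ?_) (fun x => .of_forall fun ω => ?_)
    (hB.integrable_mul hh.norm)
    (.of_forall fun ω => Complex.continuous_re.comp ((hkc ω).mul continuous_const))
  · exact Complex.continuous_re.comp_aestronglyMeasurable
      ((hk.of_uncurry_left (x := x)).aestronglyMeasurable.mul
        (Complex.continuous_conj.comp_aestronglyMeasurable hh.1))
  · refine (Complex.abs_re_le_norm _).trans ?_
    rw [norm_mul, RCLike.norm_conj]
    exact mul_le_mul_of_nonneg_right (hkB x ω) (norm_nonneg _)

theorem exists_isProbabilityMeasure_ae_integral_eq_zero {X Ω : Type*} [TopologicalSpace X]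
    [CompactSpace X] [T2Space X] [FirstCountableTopology X] [MeasurableSpace X] [BorelSpace X]
    [MeasurableSpace Ω] (ν : Measure Ω) [IsFiniteMeasure ν] (k : X → Ω → ℂ) (B : Ω → ℝ)
    (hk : Measurable (Function.uncurry k)) (hkc : ∀ ω, Continuous fun x => k x ω)
    (hB : MemLp B 2 ν) (hkB : ∀ x ω, ‖k x ω‖ ≤ B ω)
    (hneg : ∀ h : Ω → ℂ, MemLp h 2 ν →
      ∃ x, ∫ ω, (k x ω * (starRingEnd ℂ) (h ω)).re ∂ν ≤ 0) :
    ∃ P : Measure X, IsProbabilityMeasure P ∧ ∀ᵐ ω ∂ν, ∫ x, k x ω ∂P = 0 := by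
  have hkx : ∀ x, Measurable (k x) := fun x => hk.of_uncurry_left
  have hmeas : ∀ x (h : Ω → ℂ), MemLp h 2 ν →
      AEStronglyMeasurable (fun ω => (k x ω * (starRingEnd ℂ) (h ω)).re) ν := fun x h hh =>
    Complex.continuous_re.comp_aestronglyMeasurable
      ((hkx x).aestronglyMeasurable.mul
        (Complex.continuous_conj.comp_aestronglyMeasurable hh.1))
  have hbound : ∀ x (h : Ω → ℂ) ω,
      ‖(k x ω * (starRingEnd ℂ) (h ω)).re‖ ≤ B ω * ‖h ω‖ := fun x h ω => by
    refine (Complex.abs_re_le_norm _).trans ?_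
    rw [norm_mul, RCLike.norm_conj]
    exact mul_le_mul_of_nonneg_right (hkB x ω) (norm_nonneg _)
  have hBint : ∀ h : Ω → ℂ, MemLp h 2 ν → Integrable (fun ω => B ω * ‖h ω‖) ν :=
    fun h hh => hB.integrable_mul hh.norm
  have hint : ∀ x (h : Ω → ℂ), MemLp h 2 ν →
      Integrable (fun ω => (k x ω * (starRingEnd ℂ) (h ω)).re) ν := fun x h hh =>
    (hBint h hh).mono' (hmeas x h hh) (.of_forall (hbound x h))
  let V : Submodule ℝ C(X, ℝ) :=
    { carrier := {φ | ∃ h : Ω → ℂ, MemLp h 2 ν ∧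
        ∀ x, φ x = ∫ ω, (k x ω * (starRingEnd ℂ) (h ω)).re ∂ν}
      zero_mem' := ⟨0, MemLp.zero, fun x => by simp⟩
      add_mem' := by
        rintro φ ψ ⟨h, hh, hφ⟩ ⟨g, hg, hψ⟩
        refine ⟨h + g, hh.add hg, fun x => ?_⟩
        rw [ContinuousMap.add_apply, hφ, hψ, ← integral_add (hint x h hh) (hint x g hg)]
        congr 1 with ω
        simp only [Pi.add_apply, map_add, mul_add, Complex.add_re]
      smul_mem' := by
        rintro c φ ⟨h, hh, hφ⟩
        refine ⟨c • h, hh.const_smul c, fun x => ?_⟩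
        rw [ContinuousMap.smul_apply, hφ, smul_eq_mul, ← integral_const_mul]
        congr 1 with ω
        simp
        ring }
  obtain ⟨P, hP, hPV⟩ := exists_isProbabilityMeasure_integral_eq_zero V (by
    rintro φ ⟨h, hh, hφ⟩
    obtain ⟨x, hx⟩ := hneg h hh
    exact ⟨x, (hφ x).trans_le hx⟩)
  refine ⟨P, hP, ?_⟩
  let G : Ω → ℂ := fun ω => ∫ x, k x ω ∂P
  have hGm : StronglyMeasurable G := hk.stronglyMeasurable.integral_prod_left
  have hGB : ∀ ω, ‖G ω‖ ≤ B ω := fun ω => by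
    simpa using norm_integral_le_of_norm_le_const (μ := P) (f := fun x => k x ω) (C := B ω)
      (.of_forall fun x => hkB x ω)
  have hG : MemLp G 2 ν := hB.mono' hGm.aestronglyMeasurable (.of_forall hGB)
  have hcont : Continuous fun x => ∫ ω, (k x ω * (starRingEnd ℂ) (G ω)).re ∂ν :=
    continuous_integral_re_mul_conj ν k B hk hkc hB hkB G hG
  have h0 : ∫ x, ∫ ω, (k x ω * (starRingEnd ℂ) (G ω)).re ∂ν ∂P = 0 :=
    hPV ⟨_, hcont⟩ ⟨G, hG, fun x => rfl⟩
  have hprod : Integrable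
      (Function.uncurry fun x ω => (k x ω * (starRingEnd ℂ) (G ω)).re) (P.prod ν) := by
    refine ((hBint G hG).comp_snd P).mono' ?_ (.of_forall fun p => hbound p.1 G p.2)
    exact (Complex.measurable_re.comp (hk.mul (Complex.continuous_conj.measurable.comp
      (hGm.measurable.comp measurable_snd)))).aestronglyMeasurable
  rw [integral_integral_swap hprod] at h0
  have hinner : ∀ ω, ∫ x, (k x ω * (starRingEnd ℂ) (G ω)).re ∂P = ‖G ω‖ ^ 2 := fun ω => by
    have hi : Integrable (fun x => k x ω) P :=
      (integrable_const (B ω)).mono' (hkc ω).measurable.aestronglyMeasurable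
        (.of_forall fun x => hkB x ω)
    have := integral_re (𝕜 := ℂ) (hi.mul_const ((starRingEnd ℂ) (G ω)))
    simp only [RCLike.re_to_complex] at this
    rw [this, integral_mul_const]
    change (G ω * (starRingEnd ℂ) (G ω)).re = _
    rw [Complex.mul_conj, Complex.ofReal_re, Complex.normSq_eq_norm_sq]
  simp only [hinner] at h0
  rw [integral_eq_zero_iff_of_nonneg (fun ω => sq_nonneg _) (hG.integrable_norm_pow two_ne_zero)]
    at h0
  filter_upwards [h0] with ω hω
  simpa using hω

theorem exists_integral_re_nonpos_of_minimizer {X Ω : Type*} [TopologicalSpace X]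
    [CompactSpace X] [MeasurableSpace Ω] (ν : Measure Ω) [IsFiniteMeasure ν]
    (a b : X → Ω → ℂ) (m : Ω → ℂ) (C : ℝ)
    (ha : ∀ x, Measurable (a x)) (hb : ∀ x, Measurable (b x))
    (haC : ∀ x ω, ‖a x ω‖ ≤ C) (hbC : ∀ x ω, ‖b x ω‖ ≤ C) (hm : MemLp m 2 ν)
    (h : Ω → ℂ) (hh : MemLp h 2 ν)
    (hφ : Continuous fun x => ∫ ω,
      ((starRingEnd ℂ) (a x ω) * (b x ω - m ω * a x ω) * (starRingEnd ℂ) (h ω)).re ∂ν)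
    (hmin : ∀ t ε : ℝ, 0 < ε → ∃ x, ∫ ω, ‖b x ω - m ω * a x ω‖ ^ 2 ∂ν <
      (∫ ω, ‖b x ω - (m ω + t * h ω) * a x ω‖ ^ 2 ∂ν) + ε) :
    ∃ x, ∫ ω, ((starRingEnd ℂ) (a x ω) * (b x ω - m ω * a x ω) *
      (starRingEnd ℂ) (h ω)).re ∂ν ≤ 0 := by
  by_contra! hpos
  set φ : X → ℝ := fun x => ∫ ω,
      ((starRingEnd ℂ) (a x ω) * (b x ω - m ω * a x ω) * (starRingEnd ℂ) (h ω)).re ∂ν with hφd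
  have : Nonempty X := ⟨(hmin 0 1 one_pos).choose⟩
  obtain ⟨x₀, -, hx₀⟩ := isCompact_univ.exists_isMinOn univ_nonempty hφ.continuousOn
  have hx₀ : ∀ x, φ x₀ ≤ φ x := fun x => hx₀ (mem_univ x)
  have hδ : 0 < φ x₀ := hpos x₀
  set K : ℝ := C ^ 2 * ∫ ω, ‖h ω‖ ^ 2 ∂ν with hK
  have hK0 : 0 ≤ K := mul_nonneg (sq_nonneg _) (integral_nonneg fun ω => sq_nonneg _)
  have hmul : ∀ x (g : Ω → ℂ), MemLp g 2 ν → MemLp (fun ω => g ω * a x ω) 2 ν := fun x g hg =>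
    hg.of_le_mul (c := C) (hg.1.mul (ha x).aestronglyMeasurable) (.of_forall fun ω => by
      rw [norm_mul, mul_comm]
      exact mul_le_mul_of_nonneg_right (haC x ω) (norm_nonneg _))
  have hr : ∀ x, MemLp (fun ω => b x ω - m ω * a x ω) 2 ν := fun x =>
    (MemLp.of_bound (hb x).aestronglyMeasurable C (.of_forall (hbC x))).sub (hmul x m hm)
  have hexp : ∀ (t : ℝ) x, ∫ ω, ‖b x ω - (m ω + t * h ω) * a x ω‖ ^ 2 ∂ν =
      (∫ ω, ‖b x ω - m ω * a x ω‖ ^ 2 ∂ν) - 2 * t * φ x +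
        t ^ 2 * ∫ ω, ‖h ω * a x ω‖ ^ 2 ∂ν := by
    intro t x
    have hi1 := (hr x).integrable_norm_pow two_ne_zero
    have hi3 := (hmul x h hh).integrable_norm_pow two_ne_zero
    have hi2 : Integrable (fun ω => ((starRingEnd ℂ) (a x ω) * (b x ω - m ω * a x ω) *
        (starRingEnd ℂ) (h ω)).re) ν := by
      have := ((hr x).integrable_mul (hmul x h hh).star).re
      refine this.congr (.of_forall fun ω => ?_)
      simp
      ring
    have hi12 : Integrable (fun ω => ‖b x ω - m ω * a x ω‖ ^ 2 - 2 * t *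
        ((starRingEnd ℂ) (a x ω) * (b x ω - m ω * a x ω) * (starRingEnd ℂ) (h ω)).re) ν :=
      hi1.sub (hi2.const_mul _)
    rw [hφd, ← integral_const_mul, ← integral_const_mul, ← integral_sub hi1 (hi2.const_mul _),
      ← integral_add hi12 (hi3.const_mul _)]
    congr 1 with ω
    simp only [← Complex.normSq_eq_norm_sq, Complex.normSq_apply]
    simp
    ring
  have hquad : ∀ x, ∫ ω, ‖h ω * a x ω‖ ^ 2 ∂ν ≤ K := by
    intro x
    rw [hK, ← integral_const_mul]
    refine integral_mono ((hmul x h hh).integrable_norm_pow two_ne_zero)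
      ((hh.integrable_norm_pow two_ne_zero).const_mul _) fun ω => ?_
    simp only [norm_mul, mul_pow]
    rw [mul_comm]
    gcongr
    exact haC x ω
  set t : ℝ := φ x₀ / (K + 1) with ht
  have ht0 : 0 < t := by positivity
  have htK : t * K ≤ φ x₀ := by
    have : t * (K + 1) = φ x₀ := by rw [ht]; field_simp
    linarith
  obtain ⟨x, hx⟩ := hmin t (t * φ x₀) (by positivity)
  rw [hexp] at hx
  have h1 := mul_le_mul_of_nonneg_left (hquad x) (sq_nonneg t)
  have h2 := mul_le_mul_of_nonneg_left (hx₀ x) ht0.le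
  have h3 := mul_le_mul_of_nonneg_left htK ht0.le
  nlinarith

theorem norm_sub_mul_le_of_norm_le {z w c : ℂ} {C : ℝ} (hz : ‖z‖ ≤ C) (hw : ‖w‖ ≤ C) :
    ‖w - c * z‖ ≤ C * (1 + ‖c‖) := by
  refine (norm_sub_le _ _).trans ?_
  rw [norm_mul]
  nlinarith [mul_le_mul_of_nonneg_left hz (norm_nonneg c)]

theorem memLp_const_mul_one_add_norm {Ω : Type*} [MeasurableSpace Ω] {ν : Measure Ω}
    [IsFiniteMeasure ν] {m : Ω → ℂ} (hm : MemLp m 2 ν) (C : ℝ) :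
    MemLp (fun ω => C * (1 + ‖m ω‖)) 2 ν := by
  have h1 : MemLp (fun _ : Ω => (1 : ℝ)) 2 ν := memLp_const (1 : ℝ)
  exact MemLp.const_mul (f := fun ω => 1 + ‖m ω‖) (h1.add hm.norm) C

theorem exists_isProbabilityMeasure_ae_mul_integral_eq {X Ω : Type*} [TopologicalSpace X]
    [CompactSpace X] [T2Space X] [FirstCountableTopology X] [MeasurableSpace X] [BorelSpace X]
    [MeasurableSpace Ω] (ν : Measure Ω) [IsFiniteMeasure ν]
    (a b : X → Ω → ℂ) (m : Ω → ℂ) (C : ℝ) (hC : 0 ≤ C)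
    (ha : Measurable (Function.uncurry a)) (hb : Measurable (Function.uncurry b))
    (hac : ∀ ω, Continuous fun x => a x ω) (hbc : ∀ ω, Continuous fun x => b x ω)
    (haC : ∀ x ω, ‖a x ω‖ ≤ C) (hbC : ∀ x ω, ‖b x ω‖ ≤ C)
    (hmm : Measurable m) (hm : MemLp m 2 ν)
    (hmin : ∀ h : Ω → ℂ, MemLp h 2 ν → ∀ t ε : ℝ, 0 < ε →
      ∃ x, ∫ ω, ‖b x ω - m ω * a x ω‖ ^ 2 ∂ν <
        (∫ ω, ‖b x ω - (m ω + t * h ω) * a x ω‖ ^ 2 ∂ν) + ε) :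
    ∃ P : Measure X, IsProbabilityMeasure P ∧ ∀ᵐ ω ∂ν,
      m ω * ((∫ x, ‖a x ω‖ ^ 2 ∂P : ℝ) : ℂ) = ∫ x, (starRingEnd ℂ) (a x ω) * b x ω ∂P := by
  have hax : ∀ x, Measurable (a x) := fun x => ha.of_uncurry_left
  have hbx : ∀ x, Measurable (b x) := fun x => hb.of_uncurry_left
  let k : X → Ω → ℂ := fun x ω => (starRingEnd ℂ) (a x ω) * (b x ω - m ω * a x ω)
  have hkB : ∀ x ω, ‖k x ω‖ ≤ C * (C * (1 + ‖m ω‖)) := fun x ω => by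
    simp only [k, norm_mul, RCLike.norm_conj]
    exact mul_le_mul (haC x ω) (norm_sub_mul_le_of_norm_le (haC x ω) (hbC x ω)) (norm_nonneg _) hC
  have hkm : Measurable (Function.uncurry k) :=
    (Complex.continuous_conj.measurable.comp ha).mul
      (hb.sub ((hmm.comp measurable_snd).mul ha))
  have hkc : ∀ ω, Continuous fun x => k x ω := fun ω =>
    (Complex.continuous_conj.comp (hac ω)).mul ((hbc ω).sub (continuous_const.mul (hac ω)))
  have hB : MemLp (fun ω => C * (C * (1 + ‖m ω‖))) 2 ν :=
    (memLp_const_mul_one_add_norm hm C).const_mul C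
  have hneg : ∀ h : Ω → ℂ, MemLp h 2 ν →
      ∃ x, ∫ ω, (k x ω * (starRingEnd ℂ) (h ω)).re ∂ν ≤ 0 := fun h hh =>
    exists_integral_re_nonpos_of_minimizer ν a b m C hax hbx haC hbC hm h hh
      (continuous_integral_re_mul_conj ν k _ hkm hkc hB hkB h hh) (hmin h hh)
  obtain ⟨P, hP, hPk⟩ :=
    exists_isProbabilityMeasure_ae_integral_eq_zero ν k _ hkm hkc hB hkB hneg
  refine ⟨P, hP, ?_⟩
  filter_upwards [hPk] with ω hω
  have hi1 : Integrable (fun x => (starRingEnd ℂ) (a x ω) * b x ω) P :=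
    ((Complex.continuous_conj.comp (hac ω)).mul (hbc ω)).integrable_of_hasCompactSupport
      (.of_compactSpace _)
  have hi2 : Integrable (fun x => ((‖a x ω‖ ^ 2 : ℝ) : ℂ)) P :=
    (Complex.continuous_ofReal.comp ((hac ω).norm.pow 2)).integrable_of_hasCompactSupport
      (.of_compactSpace _)
  have hk : ∀ x, k x ω = (starRingEnd ℂ) (a x ω) * b x ω -
      m ω * ((‖a x ω‖ ^ 2 : ℝ) : ℂ) := fun x => by
    rw [← Complex.normSq_eq_norm_sq, Complex.normSq_eq_conj_mul_self]
    ring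
  simp only [hk] at hω
  rw [integral_sub hi1 (hi2.const_mul _), integral_const_mul, sub_eq_zero,
    integral_complex_ofReal] at hω
  exact hω.symm

theorem norm_vLow_le [CompactSpace ↥(Ω₀ ∪ α • Ω₀)] (v : C(↥(Ω₀ ∪ α • Ω₀), ℂ))
    (ξ : EuclideanSpace ℝ (Fin d)) : ‖vLow v ξ‖ ≤ ‖v‖ := by
  unfold vLow
  split_ifs
  · exact v.norm_coe_le_norm _
  · simp

theorem norm_vHigh_le [CompactSpace ↥(Ω₀ ∪ α • Ω₀)] (v : C(↥(Ω₀ ∪ α • Ω₀), ℂ))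
    (ξ : EuclideanSpace ℝ (Fin d)) : ‖vHigh v ξ‖ ≤ ‖v‖ := by
  unfold vHigh
  split_ifs
  · exact v.norm_coe_le_norm _
  · simp

theorem continuous_vLow_apply (ξ : EuclideanSpace ℝ (Fin d)) :
    Continuous fun v : C(↥(Ω₀ ∪ α • Ω₀), ℂ) => vLow v ξ := by
  unfold vLow
  split_ifs
  · exact continuous_eval_const _
  · exact continuous_const

theorem continuous_vHigh_apply (ξ : EuclideanSpace ℝ (Fin d)) :
    Continuous fun v : C(↥(Ω₀ ∪ α • Ω₀), ℂ) => vHigh v ξ := by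
  unfold vHigh
  split_ifs
  · exact continuous_eval_const _
  · exact continuous_const

theorem measurable_uncurry_vLow [CompactSpace ↥(Ω₀ ∪ α • Ω₀)]
    [MeasurableSpace C(↥(Ω₀ ∪ α • Ω₀), ℂ)] [BorelSpace C(↥(Ω₀ ∪ α • Ω₀), ℂ)]
    (hΩ : MeasurableSet Ω₀) :
    Measurable fun p : C(↥(Ω₀ ∪ α • Ω₀), ℂ) × EuclideanSpace ℝ (Fin d) => vLow p.1 p.2 := by
  let s : Set (C(↥(Ω₀ ∪ α • Ω₀), ℂ) × EuclideanSpace ℝ (Fin d)) := Prod.snd ⁻¹' Ω₀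
  have hf : Continuous fun p : s => p.1.1 ⟨p.1.2, Or.inl p.2⟩ := by fun_prop
  exact hf.measurable.dite (g := fun _ => 0) measurable_const (measurable_snd hΩ)

theorem measurable_uncurry_vHigh [CompactSpace ↥(Ω₀ ∪ α • Ω₀)]
    [MeasurableSpace C(↥(Ω₀ ∪ α • Ω₀), ℂ)] [BorelSpace C(↥(Ω₀ ∪ α • Ω₀), ℂ)]
    (hΩ : MeasurableSet Ω₀) :
    Measurable fun p : C(↥(Ω₀ ∪ α • Ω₀), ℂ) × EuclideanSpace ℝ (Fin d) => vHigh p.1 p.2 := by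
  let s : Set (C(↥(Ω₀ ∪ α • Ω₀), ℂ) × EuclideanSpace ℝ (Fin d)) := Prod.snd ⁻¹' Ω₀
  have hf : Continuous fun p : s => p.1.1 ⟨α • p.1.2, Or.inr (smul_mem_smul_set p.2)⟩ := by
    fun_prop
  exact hf.measurable.dite (g := fun _ => 0) measurable_const (measurable_snd hΩ)

theorem bddAbove_Eapp_image [CompactSpace ↥(Ω₀ ∪ α • Ω₀)]
    (μ : Measure (EuclideanSpace ℝ (Fin d))) [IsFiniteMeasure μ]
    {S : Set C(↥(Ω₀ ∪ α • Ω₀), ℂ)} {C : ℝ} (hC : ∀ v ∈ S, ‖v‖ ≤ C)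
    (m : Lp ℂ 2 (μ.restrict Ω₀)) : BddAbove ((fun v => Eapp μ v m) '' S) := by
  have hB : MemLp (fun ξ => C * (1 + ‖m ξ‖)) 2 (μ.restrict Ω₀) :=
    memLp_const_mul_one_add_norm (Lp.memLp m) C
  refine ⟨(1 / 2) * ∫ ξ in Ω₀, (C * (1 + ‖m ξ‖)) ^ 2 ∂μ, ?_⟩
  rintro _ ⟨v, hv, rfl⟩
  refine mul_le_mul_of_nonneg_left (integral_mono_of_nonneg (.of_forall fun ξ => sq_nonneg _)
    hB.integrable_sq (.of_forall fun ξ => ?_)) (by norm_num)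
  exact pow_le_pow_left₀ (norm_nonneg _) (norm_sub_mul_le_of_norm_le ((norm_vLow_le v ξ).trans (hC v hv))
    ((norm_vHigh_le v ξ).trans (hC v hv))) 2

theorem exists_integral_lt_of_forall_Ewc_le [CompactSpace ↥(Ω₀ ∪ α • Ω₀)]
    (μ : Measure (EuclideanSpace ℝ (Fin d))) [IsFiniteMeasure μ]
    {S : Set C(↥(Ω₀ ∪ α • Ω₀), ℂ)} (hSne : S.Nonempty) {m : Lp ℂ 2 (μ.restrict Ω₀)}
    (hbdd : BddAbove ((fun v => Eapp μ v m) '' S))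
    (hopt : ∀ m' : Lp ℂ 2 (μ.restrict Ω₀), Ewc μ S m ≤ Ewc μ S m')
    {g : EuclideanSpace ℝ (Fin d) → ℂ} (hg : MemLp g 2 (μ.restrict Ω₀)) {ε : ℝ} (hε : 0 < ε) :
    ∃ v : ↥S, ∫ ξ in Ω₀, ‖vHigh v.1 ξ - m ξ * vLow v.1 ξ‖ ^ 2 ∂μ <
      (∫ ξ in Ω₀, ‖vHigh v.1 ξ - (m ξ + g ξ) * vLow v.1 ξ‖ ^ 2 ∂μ) + ε := by
  by_contra! hcon
  have hae : ∀ᵐ ξ ∂μ.restrict Ω₀, (m + hg.toLp g) ξ = m ξ + g ξ := by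
    filter_upwards [Lp.coeFn_add m (hg.toLp g), hg.coeFn_toLp] with ξ h1 h2
    rw [h1, Pi.add_apply, h2]
  have hle : Ewc μ S (m + hg.toLp g) ≤ Ewc μ S m - ε / 2 := by
    refine csSup_le (hSne.image _) ?_
    rintro _ ⟨v, hv, rfl⟩
    have h1 : Eapp μ v m ≤ Ewc μ S m := le_csSup hbdd ⟨v, hv, rfl⟩
    have h2 : Eapp μ v (m + hg.toLp g) =
        (1 / 2) * ∫ ξ in Ω₀, ‖vHigh v ξ - (m ξ + g ξ) * vLow v ξ‖ ^ 2 ∂μ := by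
      unfold Eapp
      congr 1
      refine integral_congr_ae ?_
      filter_upwards [hae] with ξ hξ
      rw [hξ]
    have h3 := hcon ⟨v, hv⟩
    simp only [h2]
    unfold Eapp at h1
    linarith
  linarith [hopt (m + hg.toLp g)]

/-- Any minimizer `m_opt` of `E_wc` is, μ-a.e., the quotient of expectations
`(∫_S v* (D_α v) dΠ) / (∫_S |v|² dΠ)` for some Borel probability measure `Π` on `S`. -/
theorem stmt5 (hd : 1 ≤ d) (hα : 1 < α) (hΩ₀ : IsCompact Ω₀)
    [CompactSpace ↥(Ω₀ ∪ α • Ω₀)]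
    [MeasurableSpace C(↥(Ω₀ ∪ α • Ω₀), ℂ)] [BorelSpace C(↥(Ω₀ ∪ α • Ω₀), ℂ)]
    (μ : Measure (EuclideanSpace ℝ (Fin d))) [IsFiniteMeasure μ]
    (S : Set C(↥(Ω₀ ∪ α • Ω₀), ℂ)) (hS : IsCompact S) (hSne : S.Nonempty)
    (mopt : Lp ℂ 2 (μ.restrict Ω₀))
    (hopt : ∀ m : Lp ℂ 2 (μ.restrict Ω₀), Ewc μ S mopt ≤ Ewc μ S m) :
    ∃ P : Measure ↥S, IsProbabilityMeasure P ∧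
      (∀ᵐ ξ ∂(μ.restrict Ω₀),
        mopt ξ * ((∫ v : ↥S, ‖vLow (v : C(↥(Ω₀ ∪ α • Ω₀), ℂ)) ξ‖ ^ 2 ∂P : ℝ) : ℂ) =
          ∫ v : ↥S, (starRingEnd ℂ) (vLow (v : C(↥(Ω₀ ∪ α • Ω₀), ℂ)) ξ) *
            vHigh (v : C(↥(Ω₀ ∪ α • Ω₀), ℂ)) ξ ∂P) ∧
      (∀ᵐ ξ ∂(μ.restrict Ω₀),
        ((∫ v : ↥S, ‖vLow (v : C(↥(Ω₀ ∪ α • Ω₀), ℂ)) ξ‖ ^ 2 ∂P : ℝ) ≠ 0 →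
          mopt ξ = (∫ v : ↥S, (starRingEnd ℂ) (vLow (v : C(↥(Ω₀ ∪ α • Ω₀), ℂ)) ξ) *
              vHigh (v : C(↥(Ω₀ ∪ α • Ω₀), ℂ)) ξ ∂P) /
            ((∫ v : ↥S, ‖vLow (v : C(↥(Ω₀ ∪ α • Ω₀), ℂ)) ξ‖ ^ 2 ∂P : ℝ) : ℂ))) := by
  obtain ⟨C, hC⟩ := hS.isBounded.exists_norm_le
  have hC0 : 0 ≤ C := (norm_nonneg _).trans (hC _ hSne.some_mem)
  have : CompactSpace ↥S := isCompact_iff_compactSpace.mp hS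
  obtain ⟨P, hP, key⟩ := exists_isProbabilityMeasure_ae_mul_integral_eq (X := ↥S)
    (μ.restrict Ω₀) (fun v ξ => vLow v.1 ξ) (fun v ξ => vHigh v.1 ξ) mopt C hC0
    ((measurable_uncurry_vLow hΩ₀.measurableSet).comp
      (measurable_subtype_coe.prodMap measurable_id))
    ((measurable_uncurry_vHigh hΩ₀.measurableSet).comp
      (measurable_subtype_coe.prodMap measurable_id))
    (fun ξ => (continuous_vLow_apply ξ).comp continuous_subtype_val)
    (fun ξ => (continuous_vHigh_apply ξ).comp continuous_subtype_val)
    (fun v ξ => (norm_vLow_le v.1 ξ).trans (hC _ v.2))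
    (fun v ξ => (norm_vHigh_le v.1 ξ).trans (hC _ v.2))
    (Lp.stronglyMeasurable mopt).measurable (Lp.memLp mopt)
    (fun h hh t ε hε => exists_integral_lt_of_forall_Ewc_le μ hSne
      (bddAbove_Eapp_image μ hC mopt) hopt (hh.const_mul (t : ℂ)) hε)
  refine ⟨P, hP, key, ?_⟩
  filter_upwards [key] with ξ hξ hne
  exact eq_div_of_mul_eq (Complex.ofReal_ne_zero.2 hne) hξ
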